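/- Let Ω ⊆ ℍ be open and s : Ω → ℂ be holomorphic, and define η(τ) := s'(τ) − Im s(τ)/Im τ. Then the function ξ(τ) := ∂η/∂τ(τ) − i·η(τ)/(2·Im τ), where ∂η/∂τ is the (1,0)-Wirtinger derivative of η, is holomorphic on Ω. (That is, the covariant derivative ∇η of the verticality with respect to the Hermitian connection of the invariant metric on the half-canonical bundle is a holomorphic section.) -/

import Mathlib

/-- The (1,0)-Wirtinger derivative `∂f/∂τ` of a function `f : ℂ → ℂ` at a point. -/
noncomputable def wdz (f : ℂ → ℂ) (w : ℂ) : ℂ :=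
  (1 / 2) * (fderiv ℝ f w 1 - Complex.I * fderiv ℝ f w Complex.I)

theorem HasFDerivAt.wdz_eq {f : ℂ → ℂ} {f' : ℂ →L[ℝ] ℂ} {w : ℂ} (h : HasFDerivAt f f' w) :
    wdz f w = (1 / 2) * (f' 1 - Complex.I * f' Complex.I) := by
  rw [wdz, h.fderiv]

/-- The Wirtinger derivative of `g - Im s / Im` for `g` and `s` complex differentiable. -/
theorem wdz_sub_im_div_im {g s : ℂ → ℂ} {g' s' w : ℂ} (hg : HasDerivAt g g' w)
    (hs : HasDerivAt s s' w) (hw : w.im ≠ 0) :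
    wdz (fun τ => g τ - (((s τ).im / τ.im : ℝ) : ℂ)) w =
      g' + Complex.I * s' / (2 * (w.im : ℂ)) - Complex.I * (s w).im / (2 * (w.im : ℂ) ^ 2) := by
  have him : HasFDerivAt (fun τ : ℂ => τ.im) Complex.imCLM w := Complex.imCLM.hasFDerivAt
  have hsim : HasFDerivAt (fun τ => (s τ).im) _ w :=
    Complex.imCLM.hasFDerivAt.comp w (hs.hasFDerivAt.restrictScalars ℝ)
  have hinv : HasFDerivAt (fun τ : ℂ => τ.im⁻¹) _ w :=
    (hasDerivAt_inv hw).comp_hasFDerivAt w him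
  have hquot : HasFDerivAt (fun τ => (((s τ).im / τ.im : ℝ) : ℂ)) _ w :=
    Complex.ofRealCLM.hasFDerivAt.comp w (hsim.mul hinv)
  have hw' : (w.im : ℂ) ≠ 0 := Complex.ofReal_ne_zero.mpr hw
  rw [((hg.hasFDerivAt.restrictScalars ℝ).fun_sub hquot).wdz_eq]
  have hs' : s' = s'.re + s'.im * Complex.I := (Complex.re_add_im s').symm
  simp
  field_simp
  ring_nf
  simp only [Complex.I_sq]
  linear_combination (-(w.im : ℂ) * Complex.I) * hs' - w.im * s'.im * Complex.I_sq

/-- Let `Ω ⊆ ℍ` be open, `s : Ω → ℂ` holomorphic, and `η(τ) = s'(τ) − Im s(τ)/Im τ` the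
verticality of the section `τ ↦ (τ, s(τ))`. Then the covariant derivative
`ξ(τ) = ∂η/∂τ(τ) − i·η(τ)/(2·Im τ)` is holomorphic on `Ω`. -/
theorem stmt_9 (Ω : Set ℂ) (hΩ : IsOpen Ω) (hΩH : ∀ τ ∈ Ω, 0 < τ.im)
    (s : ℂ → ℂ) (hs : DifferentiableOn ℂ s Ω)
    (η : ℂ → ℂ) (hη : ∀ τ, η τ = deriv s τ - (((s τ).im / τ.im : ℝ) : ℂ))
    (ξ : ℂ → ℂ)
    (hξ : ∀ τ, ξ τ = wdz η τ - Complex.I * η τ / (2 * (τ.im : ℂ))) :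
    DifferentiableOn ℂ ξ Ω := by
  have hs' := hs.deriv hΩ
  refine (hs'.deriv hΩ).congr fun τ hτ => ?_
  have him := (hΩH τ hτ).ne'
  have him' : (τ.im : ℂ) ≠ 0 := Complex.ofReal_ne_zero.mpr him
  have hτΩ := hΩ.mem_nhds hτ
  rw [hξ, hη, funext hη, wdz_sub_im_div_im (hs'.differentiableAt hτΩ).hasDerivAt
    (hs.differentiableAt hτΩ).hasDerivAt him]
  push_cast
  field_simp
  ring
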